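/- arXiv:1005.0774 — 4 statements merged into one kernel-verified Lean document; each statement's English description precedes it below -/
import Mathlib

section
/- Let a < b be reals such that the open interval (a,b) contains no point of Spec(A). Then for every subspace 𝓛 ⊆ H, Spec₂(A,𝓛) ∩ D(a,b) = ∅. -/
open scoped InnerProductSpace
open Module Filter

variable {H : Type*}

/-- The second order spectrum of `A` relative to the subspace `L`:
`z` such that some nonzero `u ∈ L` satisfies `⟨(A−z)u,(A−z̄)v⟩ = 0` for all `v ∈ L`
(the paper's inner product is linear in the first argument, so it is the Mathlib
inner product with the arguments swapped). -/
def secondOrderSpectrum [NormedAddCommGroup H] [InnerProductSpace ℂ H]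
    (A : H →L[ℂ] H) (L : Submodule ℂ H) : Set ℂ :=
  {z | ∃ u ∈ L, u ≠ 0 ∧ ∀ v ∈ L, ⟪A v - (starRingEnd ℂ z) • v, A u - z • u⟫_ℂ = 0}

/-- The open disc `D(a,b)` with centre `(a+b)/2` and radius `(b-a)/2`. -/
noncomputable def discD (a b : ℝ) : Set ℂ :=
  Metric.ball (((a + b) / 2 : ℝ) : ℂ) ((b - a) / 2)

/-- The closed disc `D[a,b]`. -/
noncomputable def discDcl (a b : ℝ) : Set ℂ :=
  Metric.closedBall (((a + b) / 2 : ℝ) : ℂ) ((b - a) / 2)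

/-- If the open interval `(a,b)` contains no point of `Spec(A)`, then for every
subspace `L`, `Spec₂(A,L) ∩ D(a,b) = ∅`. -/
theorem secondOrderSpectrum_inter_discD_eq_empty
    [NormedAddCommGroup H] [InnerProductSpace ℂ H] [CompleteSpace H]
    (A : H →L[ℂ] H) (hA : IsSelfAdjoint A)
    (a b : ℝ) (hab : a < b)
    (hgap : ∀ μ : ℝ, a < μ → μ < b → (μ : ℂ) ∉ spectrum ℂ A)
    (L : Submodule ℂ H) :
    secondOrderSpectrum A L ∩ discD a b = ∅ := by
  have hpos : (0 : H →L[ℂ] H) ≤ A * A - (a + b) • A + (a * b) • (1 : H →L[ℂ] H) := by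
    have h0 : (0 : H →L[ℂ] H) ≤ cfc (fun t : ℝ => t * t - (a + b) * t + a * b) A := by
      apply cfc_nonneg
      intro t ht
      have h1 : (t : ℂ) ∈ spectrum ℂ A := by
        have := spectrum.algebraMap_mem ℂ ht
        simpa using this
      by_cases hat : a < t
      · by_cases htb : t < b
        · exact absurd h1 (hgap t hat htb)
        · nlinarith [mul_nonneg (sub_nonneg.2 hat.le) (sub_nonneg.2 (not_lt.1 htb))]
      · push Not at hat
        nlinarith [mul_nonneg (sub_nonneg.2 hat) (sub_nonneg.2 (hat.trans hab.le))]
    have h2 : cfc (fun t : ℝ => t * t - (a + b) * t + a * b) A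
        = A * A - (a + b) • A + (a * b) • (1 : H →L[ℂ] H) := by
      rw [cfc_add .., cfc_sub .., cfc_mul .., cfc_const_mul .., cfc_const .., cfc_id' ..,
        Algebra.algebraMap_eq_smul_one]
    rwa [h2] at h0
  rw [Set.eq_empty_iff_forall_notMem]
  rintro z ⟨⟨u, huL, hu, horth⟩, hz⟩
  have hz0 := horth u huL
  have hsym : ∀ x y : H, ⟪A x, y⟫_ℂ = ⟪x, A y⟫_ℂ := fun x y => hA.isSymmetric x y
  have hQim : (⟪u, A u⟫_ℂ).im = 0 := by
    have := inner_conj_symm (𝕜 := ℂ) u (A u)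
    rw [hsym] at this
    exact Complex.conj_eq_iff_im.1 this
  set Q := (⟪u, A u⟫_ℂ).re with hQ
  have hQ' : ⟪u, A u⟫_ℂ = (Q : ℂ) := by
    apply Complex.ext <;> simp [hQ, hQim]
  have hP : ⟪A u, A u⟫_ℂ = ((‖A u‖ ^ 2 : ℝ) : ℂ) := by
    rw [inner_self_eq_norm_sq_to_K]; simp
  have hN : ⟪u, u⟫_ℂ = ((‖u‖ ^ 2 : ℝ) : ℂ) := by
    rw [inner_self_eq_norm_sq_to_K]; simp
  have hNpos : 0 < ‖u‖ ^ 2 := by positivity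
  have hineq : 0 ≤ ‖A u‖ ^ 2 - (a + b) * Q + a * b * ‖u‖ ^ 2 := by
    have h3 := ((ContinuousLinearMap.nonneg_iff_isPositive _).1 hpos).inner_nonneg_right u
    have h4 : ⟪u, (A * A - (a + b) • A + (a * b) • (1 : H →L[ℂ] H)) u⟫_ℂ
        = ((‖A u‖ ^ 2 - (a + b) * Q + a * b * ‖u‖ ^ 2 : ℝ) : ℂ) := by
      simp only [ContinuousLinearMap.add_apply, ContinuousLinearMap.sub_apply,
        ContinuousLinearMap.smul_apply, ContinuousLinearMap.mul_apply,
        ContinuousLinearMap.one_apply, inner_add_right, inner_sub_right,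
        inner_smul_right_eq_smul]
      rw [← hsym, hP, hQ', hN]
      simp
    rw [h4] at h3
    exact_mod_cast h3
  have hCS : Q ^ 2 ≤ ‖A u‖ ^ 2 * ‖u‖ ^ 2 := by
    have h10 := norm_inner_le_norm (𝕜 := ℂ) u (A u)
    rw [hQ', Complex.norm_real, Real.norm_eq_abs] at h10
    have h11 := pow_le_pow_left₀ (abs_nonneg Q) h10 2
    rw [sq_abs] at h11
    linarith [mul_pow ‖u‖ ‖A u‖ 2, mul_comm (‖u‖ ^ 2) (‖A u‖ ^ 2)]
  generalize ‖A u‖ ^ 2 = P at *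
  have hz1 : (P : ℂ) - 2 * z * Q + z ^ 2 * ((‖u‖ ^ 2 : ℝ) : ℂ) = 0 := by
    rw [← hz0]
    simp only [inner_sub_left, inner_sub_right, inner_smul_left, inner_smul_right,
      Complex.conj_conj]
    rw [hsym u u, hQ', hP, hN]
    ring
  generalize ‖u‖ ^ 2 = N at *
  have hre := congrArg Complex.re hz1
  have him := congrArg Complex.im hz1
  simp [pow_two] at hre him
  have hd : (z.re - (a + b) / 2) ^ 2 + z.im ^ 2 < ((b - a) / 2) ^ 2 := by
    rw [discD, Metric.mem_ball, Complex.dist_eq] at hz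
    have h5 := pow_lt_pow_left₀ hz (norm_nonneg _) (two_ne_zero)
    rw [← Complex.normSq_eq_norm_sq, Complex.normSq_apply] at h5
    simp only [Complex.sub_re, Complex.sub_im, Complex.ofReal_re, Complex.ofReal_im] at h5
    nlinarith
  have hQx : Q = z.re * N := by
    by_cases hy : z.im = 0
    · rw [hy] at hre
      have h6 : (Q - z.re * N) ^ 2 ≤ 0 := by
        have h7 : N * (P - 2 * z.re * Q + z.re * z.re * N) = 0 := by
          have : P - 2 * z.re * Q + z.re * z.re * N = 0 := by linarith
          rw [this, mul_zero]
        nlinarith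
      nlinarith [pow_eq_zero_iff (two_ne_zero) |>.1 (le_antisymm h6 (sq_nonneg _))]
    · have h8 : z.im * (Q - z.re * N) = 0 := by linarith
      rcases mul_eq_zero.1 h8 with h | h
      · exact absurd h hy
      · linarith
  have hPx : P = (z.re ^ 2 + z.im ^ 2) * N := by
    rw [hQx] at hre him
    nlinarith
  have h9 := mul_lt_mul_of_pos_right hd hNpos
  rw [hPx, hQx] at hineq
  nlinarith
end

section
/- Let a, b, c, d ∈ ℝ with ad ≠ cb, suppose g(A) := cA + d·Id is invertible in the bounded operators on H, and set F(A) := (aA + b·Id)(cA + d·Id)^{-1}. Let b₁,…,b_n be a basis of a finite-dimensional subspace 𝓛 ⊆ H and set b̃_j := g(A) b_j (a basis of g(A)𝓛). Let B, L, M ∈ ℂ^{n×n} be defined by B_{jk} = ⟨A b_k, A b_j⟩, L_{jk} = ⟨A b_k, b_j⟩, M_{jk} = ⟨b_k, b_j⟩, and let B̃, L̃, M̃ ∈ ℂ^{n×n} be defined by B̃_{jk} = ⟨F(A) b̃_k, F(A) b̃_j⟩, L̃_{jk} = ⟨F(A) b̃_k, b̃_j⟩, M̃_{jk} = ⟨b̃_k,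 b̃_j⟩. Then for every z ∈ ℂ with cz + d ≠ 0, writing F(z) := (az+b)/(cz+d), one has the matrix identity B − 2zL + z²M = (ad − cb)^{-2} (cz+d)² (B̃ − 2F(z)L̃ + F(z)² M̃). -/
open scoped InnerProductSpace
open Module Filter

variable {H : Type*}

/-- The key matrix identity in the proof of the paper's spectral mapping lemma:
for the quadratic pencils assembled from a basis `b₁,…,bₙ` of `L` for `A`, and
from the basis `g(A)b₁,…,g(A)bₙ` of `g(A)L` for `F(A) = (aA+b)(cA+d)⁻¹`,
`B − 2zL + z²M = (ad − cb)⁻² (cz+d)² (B̃ − 2F(z)L̃ + F(z)²M̃)`.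
(The paper's inner product `⟨x,y⟩`, linear in `x`, is `⟪y,x⟫` in Mathlib.) -/
theorem quadratic_pencil_moebius_identity
    [NormedAddCommGroup H] [InnerProductSpace ℂ H] [CompleteSpace H]
    (A : H →L[ℂ] H) (hA : IsSelfAdjoint A)
    (a b c d : ℝ) (habcd : a * d ≠ c * b)
    (hg : IsUnit ((c : ℂ) • A + (d : ℂ) • (1 : H →L[ℂ] H)))
    (L : Submodule ℂ H) [FiniteDimensional ℂ L]
    (n : ℕ) (bv : Fin n → H) (hbv : LinearIndependent ℂ bv)
    (hspan : Submodule.span ℂ (Set.range bv) = L) :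
    ∀ z : ℂ, (c : ℂ) * z + (d : ℂ) ≠ 0 →
      ∀ j k : Fin n,
        letI g : H →L[ℂ] H := (c : ℂ) • A + (d : ℂ) • (1 : H →L[ℂ] H)
        letI F : H →L[ℂ] H :=
          ((a : ℂ) • A + (b : ℂ) • (1 : H →L[ℂ] H)) * Ring.inverse g
        letI Fz : ℂ := ((a : ℂ) * z + (b : ℂ)) / ((c : ℂ) * z + (d : ℂ))
        ⟪A (bv j), A (bv k)⟫_ℂ - 2 * z * ⟪bv j, A (bv k)⟫_ℂ +
            z ^ 2 * ⟪bv j, bv k⟫_ℂ =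
          (((a : ℂ) * (d : ℂ) - (c : ℂ) * (b : ℂ))⁻¹) ^ 2 * ((c : ℂ) * z + (d : ℂ)) ^ 2 *
            (⟪F (g (bv j)), F (g (bv k))⟫_ℂ - 2 * Fz * ⟪g (bv j), F (g (bv k))⟫_ℂ +
              Fz ^ 2 * ⟪g (bv j), g (bv k)⟫_ℂ) := by
  intro z hz j k
  have hinv : ∀ x : H, (((a : ℂ) • A + (b : ℂ) • (1 : H →L[ℂ] H)) *
      Ring.inverse ((c : ℂ) • A + (d : ℂ) • (1 : H →L[ℂ] H)))
      (((c : ℂ) • A + (d : ℂ) • (1 : H →L[ℂ] H)) x) = (a : ℂ) • A x + (b : ℂ) • x := by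
    intro x
    have h := Ring.inverse_mul_cancel _ hg
    have h2 := congrArg (fun T : H →L[ℂ] H => T x) h
    have h3 : Ring.inverse ((c : ℂ) • A + (d : ℂ) • (1 : H →L[ℂ] H))
      (((c : ℂ) • A + (d : ℂ) • (1 : H →L[ℂ] H)) x) = x := h2
    rw [mul_apply_eq_comp, h3]
    rfl
  have hgx : ∀ x : H, ((c : ℂ) • A + (d : ℂ) • (1 : H →L[ℂ] H)) x
      = (c : ℂ) • A x + (d : ℂ) • x := fun x => rfl
  have hsym : ⟪A (bv j), bv k⟫_ℂ = ⟪bv j, A (bv k)⟫_ℂ :=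
    hA.isSymmetric (bv j) (bv k)
  have hD : (a : ℂ) * (d : ℂ) - (c : ℂ) * (b : ℂ) ≠ 0 := by
    rw [sub_ne_zero]
    exact_mod_cast habcd
  simp only [hinv]
  simp only [hgx, inner_add_left, inner_add_right, inner_smul_left, inner_smul_right,
    Complex.conj_ofReal, hsym]
  generalize ⟪A (bv j), A (bv k)⟫_ℂ = P
  generalize ⟪bv j, A (bv k)⟫_ℂ = Q
  generalize ⟪bv j, bv k⟫_ℂ = R
  have hz2 : z * (c : ℂ) + (d : ℂ) ≠ 0 := by rwa [mul_comm]
  generalize (c : ℂ) = cc at *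
  generalize (d : ℂ) = dd at *
  generalize (a : ℂ) = aa at *
  generalize (b : ℂ) = bb at *
  clear hinv hgx hg
  field_simp
  ring
end

section
/- Let c, a, θ ∈ ℝ with −1 < c < 1, 0 ≤ θ ≤ π and |c| ≤ a ≤ 1, and set z := a(cos θ + i sin θ), β₊ := (1/2)·( (a² + c)/(1 + c) − a cos θ ) and β₋ := (1/2)·( (a² − c)/(1 − c) + a cos θ ). If z ∈ 𝔸(−1, c, 1), then β₊ ≥ 0 and β₋ ≥ 0. -/
open scoped InnerProductSpace
open Module Filter

variable {H : Type*}

/-- The region `𝔸(c₁,c₂,c₃) = D[c₁,c₃] \ (D(c₁,c₂) ∪ D(c₂,c₃))`. -/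
noncomputable def regionA3 (c₁ c₂ c₃ : ℝ) : Set ℂ :=
  discDcl c₁ c₃ \ (discD c₁ c₂ ∪ discD c₂ c₃)

/-- A point outside `D(p,q)` satisfies the expanded quadratic inequality. -/
lemma quad_of_not_mem_discD (p q x y : ℝ) (hpq : p ≤ q) (z : ℂ) (hre : z.re = x) (him : z.im = y)
    (h : z ∉ discD p q) : 0 ≤ x ^ 2 + y ^ 2 - (p + q) * x + p * q := by
  unfold discD at h
  rw [Metric.mem_ball, not_lt, Complex.dist_eq] at h
  have h2 := pow_le_pow_left₀ (by linarith) h 2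
  rw [Complex.sq_norm, Complex.normSq_apply, Complex.sub_re, Complex.sub_im,
    Complex.ofReal_re, Complex.ofReal_im, hre, him] at h2
  nlinarith

/-- Lemma 5.4 of the paper (trigonometric part): for `z = a e^{iθ} ∈ 𝔸(-1,c,1)`,
the quantities `β₊` and `β₋` are nonnegative. -/
theorem beta_nonneg_of_mem_regionA3
    (c a θ : ℝ) (hc1 : -1 < c) (hc2 : c < 1)
    (hθ0 : 0 ≤ θ) (hθπ : θ ≤ Real.pi)
    (hca : |c| ≤ a) (ha1 : a ≤ 1)
    (z : ℂ) (hz : z = (a : ℂ) * ((Real.cos θ : ℂ) + (Real.sin θ : ℂ) * Complex.I))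
    (hzA : z ∈ regionA3 (-1) c 1) :
    0 ≤ (1 / 2) * ((a ^ 2 + c) / (1 + c) - a * Real.cos θ) ∧
      0 ≤ (1 / 2) * ((a ^ 2 - c) / (1 - c) + a * Real.cos θ) := by
  obtain ⟨-, hn⟩ := hzA
  have hre : z.re = a * Real.cos θ := by
    rw [hz, Complex.re_ofReal_mul]
    simp [-Complex.ofReal_cos, -Complex.ofReal_sin]
  have him : z.im = a * Real.sin θ := by
    rw [hz, Complex.im_ofReal_mul]
    simp [-Complex.ofReal_cos, -Complex.ofReal_sin]
  have h1 := quad_of_not_mem_discD (-1) c _ _ hc1.le z hre him (fun h => hn (Or.inl h))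
  have h2 := quad_of_not_mem_discD c 1 _ _ hc2.le z hre him (fun h => hn (Or.inr h))
  have hs : (a * Real.cos θ) ^ 2 + (a * Real.sin θ) ^ 2 = a ^ 2 := by
    rw [mul_pow, mul_pow, ← mul_add, Real.cos_sq_add_sin_sq, mul_one]
  rw [hs] at h1 h2
  have k1 : a * Real.cos θ ≤ (a ^ 2 + c) / (1 + c) := by
    rw [le_div_iff₀ (by linarith)]
    linarith
  have k2 : -(a * Real.cos θ) ≤ (a ^ 2 - c) / (1 - c) := by
    rw [le_div_iff₀ (by linarith)]
    linarith
  constructor <;> linarith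
end

section
/- Let c₁ ≤ c₂ ≤ c₃ be reals and let x₁, x₂, x₃ ∈ H be orthonormal vectors with A x_k = c_k·x_k for k = 1, 2, 3. Then for every z ∈ 𝔸(c₁,c₂,c₃) there exist α₁, α₂, α₃ ∈ ℝ with α₁² + α₂² + α₃² = 1 such that y := α₁x₁ + α₂x₂ + α₃x₃ satisfies ⟨Ay, Ay⟩ − 2z⟨Ay, y⟩ + z²⟨y, y⟩ = 0; equivalently, z (and hence also conj(z)) is a root of the real quadratic λ² − 2⟨Ay,y⟩λ + ⟨Ay,Ay⟩, so that z ∈ Spec₂(A, ℂ·y). -/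
open scoped InnerProductSpace
open Module Filter

variable {H : Type*}

lemma real_weights (a b c s N : ℝ) (hab : a ≤ b) (hbc : b ≤ c) (hN : s ^ 2 ≤ N)
    (h13 : N - (a + c) * s + a * c ≤ 0)
    (h12 : 0 ≤ N - (a + b) * s + a * b) (h23 : 0 ≤ N - (b + c) * s + b * c) :
    ∃ p q r : ℝ, 0 ≤ p ∧ 0 ≤ q ∧ 0 ≤ r ∧ p + q + r = 1 ∧ p * a + q * b + r * c = s ∧
      p * a ^ 2 + q * b ^ 2 + r * c ^ 2 = N := by
  rcases (hab.trans hbc).eq_or_lt with hac | hac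
  · have hb : b = a := by linarith
    subst hb
    subst hac
    have hs : s = b := by
      have : (s - b) ^ 2 = 0 := le_antisymm (by nlinarith) (sq_nonneg _)
      have := pow_eq_zero_iff (two_ne_zero) |>.1 this
      linarith
    subst hs
    exact ⟨1, 0, 0, by norm_num, le_rfl, le_rfl, by norm_num, by ring, by nlinarith⟩
  by_cases hd : a < b ∧ b < c
  · obtain ⟨h1, h2⟩ := hd
    have e1 : 0 < b - a := by linarith
    have e2 : 0 < c - b := by linarith
    have e3 : 0 < c - a := by linarith
    refine ⟨(N - (b + c) * s + b * c) / ((b - a) * (c - a)),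
      -(N - (a + c) * s + a * c) / ((b - a) * (c - b)),
      (N - (a + b) * s + a * b) / ((c - a) * (c - b)),
      by positivity, div_nonneg (by linarith) (by positivity), by positivity, ?_, ?_, ?_⟩ <;>
    · field_simp
      ring
  · have h0 : N - (a + c) * s + a * c = 0 := by
      apply le_antisymm h13
      rcases hab.eq_or_lt with h | h
      · subst h; exact h23
      · rcases hbc.eq_or_lt with hlt | hlt
        · subst hlt; exact h12
        · exact absurd ⟨h, hlt⟩ hd
    have e3 : 0 < c - a := by linarith
    have g1 : 0 ≤ c - s := by
      by_contra! h
      nlinarith [mul_pos (show 0 < s - c by linarith) (show 0 < s - a by linarith)]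
    have g2 : 0 ≤ s - a := by
      by_contra! h
      nlinarith [mul_pos (show 0 < c - s by linarith) (show 0 < a - s by linarith)]
    have hNeq : N = (a + c) * s - a * c := by linarith
    subst hNeq
    refine ⟨(c - s) / (c - a), 0, (s - a) / (c - a), by positivity, le_rfl, by positivity,
      ?_, ?_, ?_⟩ <;>
    · field_simp
      ring

lemma dist_sq_real (z : ℂ) (a b : ℝ) :
    dist z (((a + b) / 2 : ℝ) : ℂ) ^ 2
      = (z.re ^ 2 + z.im ^ 2 - (a + b) * z.re + a * b) + ((b - a) / 2) ^ 2 := by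
  rw [Complex.dist_eq, Complex.sq_norm, Complex.normSq_apply]
  simp only [Complex.sub_re, Complex.sub_im, Complex.ofReal_re, Complex.ofReal_im]
  ring

lemma not_mem_discD {z : ℂ} {a b : ℝ} (h : a ≤ b) (hz : z ∉ discD a b) :
    0 ≤ z.re ^ 2 + z.im ^ 2 - (a + b) * z.re + a * b := by
  rw [discD, Metric.mem_ball, not_lt] at hz
  have := dist_sq_real z a b
  have := pow_le_pow_left₀ (by linarith) hz 2
  linarith

lemma mem_discDcl {z : ℂ} {a b : ℝ} (hz : z ∈ discDcl a b) :
    z.re ^ 2 + z.im ^ 2 - (a + b) * z.re + a * b ≤ 0 := by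
  rw [discDcl, Metric.mem_closedBall] at hz
  have := dist_sq_real z a b
  have := pow_le_pow_left₀ dist_nonneg hz 2
  linarith

/-- Lemma 5.4 of the paper (exact, unperturbed case): from three orthonormal
eigenvectors with eigenvalues `c₁ ≤ c₂ ≤ c₃` one constructs, for any
`z ∈ 𝔸(c₁,c₂,c₃)`, a real unit combination `y` with
`⟨Ay,Ay⟩ − 2z⟨Ay,y⟩ + z²⟨y,y⟩ = 0`, so that `z ∈ Spec₂(A, ℂ·y)`. -/
theorem exists_combination_secondOrderSpectrum_of_mem_regionA3
    [NormedAddCommGroup H] [InnerProductSpace ℂ H] [CompleteSpace H]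
    (A : H →L[ℂ] H) (hA : IsSelfAdjoint A)
    (c₁ c₂ c₃ : ℝ) (h12 : c₁ ≤ c₂) (h23 : c₂ ≤ c₃)
    (x : Fin 3 → H) (hON : Orthonormal ℂ x)
    (he1 : A (x 0) = (c₁ : ℂ) • x 0)
    (he2 : A (x 1) = (c₂ : ℂ) • x 1)
    (he3 : A (x 2) = (c₃ : ℂ) • x 2) :
    ∀ z ∈ regionA3 c₁ c₂ c₃,
      ∃ α : Fin 3 → ℝ, (∑ k, α k ^ 2) = 1 ∧
        ∀ y : H, y = ∑ k, ((α k : ℂ)) • x k →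
          ⟪A y, A y⟫_ℂ - 2 * z * ⟪y, A y⟫_ℂ + z ^ 2 * ⟪y, y⟫_ℂ = 0 ∧
            z ∈ secondOrderSpectrum A (Submodule.span ℂ {y}) := by
  intro z hz
  obtain ⟨hz13, hzn⟩ := hz
  rw [Set.mem_union, not_or] at hzn
  obtain ⟨p, q, r, hp, hq, hr, hs, hm, hN⟩ := real_weights c₁ c₂ c₃ z.re (z.re ^ 2 + z.im ^ 2)
    h12 h23 (by nlinarith [sq_nonneg z.im]) (mem_discDcl hz13) (not_mem_discD h12 hzn.1)
    (not_mem_discD h23 hzn.2)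
  have sp := Real.mul_self_sqrt hp
  have sqq := Real.mul_self_sqrt hq
  have sr := Real.mul_self_sqrt hr
  refine ⟨![√p, √q, √r], ?_, ?_⟩
  · simp [Fin.sum_univ_three, Real.sq_sqrt, hp, hq, hr, hs]
  intro y hy
  have key : ∀ u v : Fin 3 → ℂ, ⟪∑ k, u k • x k, ∑ k, v k • x k⟫_ℂ
      = ∑ k, (starRingEnd ℂ) (u k) * v k := fun u v => hON.inner_sum u v Finset.univ
  have hAy : A y = ∑ k, (![(√p : ℂ) * c₁, (√q : ℂ) * c₂, (√r : ℂ) * c₃] k) • x k := by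
    rw [hy]
    simp [Fin.sum_univ_three, he1, he2, he3, smul_smul, -Complex.coe_smul]
  have hysum : y = ∑ k, (![(√p : ℂ), (√q : ℂ), (√r : ℂ)] k) • x k := by
    rw [hy]
    simp [Fin.sum_univ_three]
  have cp : (√p : ℂ) * √p = p := by exact_mod_cast sp
  have cq : (√q : ℂ) * √q = q := by exact_mod_cast sqq
  have cr : (√r : ℂ) * √r = r := by exact_mod_cast sr
  have cs : (p : ℂ) + q + r = 1 := by exact_mod_cast hs
  have cm : (p : ℂ) * c₁ + q * c₂ + r * c₃ = z.re := by exact_mod_cast hm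
  have cN : (p : ℂ) * c₁ ^ 2 + q * c₂ ^ 2 + r * c₃ ^ 2 = (z.re : ℂ) ^ 2 + (z.im : ℂ) ^ 2 := by
    exact_mod_cast hN
  have i1 : ⟪y, y⟫_ℂ = 1 := by
    rw [hysum, key]
    simp [Fin.sum_univ_three]
    linear_combination cp + cq + cr + cs
  have i2 : ⟪y, A y⟫_ℂ = z.re := by
    rw [hAy, hysum, key]
    simp [Fin.sum_univ_three]
    linear_combination c₁ * cp + c₂ * cq + c₃ * cr + cm
  have i2b : ⟪A y, y⟫_ℂ = z.re := by
    rw [hAy, hysum, key]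
    simp [Fin.sum_univ_three]
    linear_combination c₁ * cp + c₂ * cq + c₃ * cr + cm
  have i3 : ⟪A y, A y⟫_ℂ = (z.re : ℂ) ^ 2 + (z.im : ℂ) ^ 2 := by
    rw [hAy, key]
    simp [Fin.sum_univ_three]
    linear_combination c₁ ^ 2 * cp + c₂ ^ 2 * cq + c₃ ^ 2 * cr + cN
  have hzz : (z.re : ℂ) ^ 2 + (z.im : ℂ) ^ 2 - 2 * z * z.re + z ^ 2 = 0 := by
    have h := Complex.re_add_im z
    have hI := Complex.I_sq
    linear_combination (-(z + z.re + z.im * Complex.I) + 2 * z.re) * h + (z.im : ℂ) ^ 2 * hI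
  refine ⟨by rw [i1, i2, i3]; linear_combination hzz, y, Submodule.mem_span_singleton_self y, ?_, ?_⟩
  · intro h0
    rw [h0, inner_zero_left] at i1
    exact zero_ne_one i1
  · intro v hv
    obtain ⟨a, rfl⟩ := Submodule.mem_span_singleton.1 hv
    simp only [map_smul, inner_sub_left, inner_sub_right, inner_smul_left, inner_smul_right,
      i1, i2, i2b, i3, Complex.conj_conj]
    linear_combination (starRingEnd ℂ a) * hzz
end
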